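/- Let f(x,y) be a real homogeneous polynomial of degree n ≥ 3 without multiple complex roots, and suppose that for every (α,β) ∈ ℝ² \ {(0,0)} the polynomial α·f_x + β·f_y has n−1 distinct real roots. Then f has n distinct real roots. -/

import Mathlib

open MvPolynomial

/-- The real linear binary form `p.1 * x + p.2 * y`. -/
noncomputable def lin (p : ℝ × ℝ) : MvPolynomial (Fin 2) ℝ :=
  C p.1 * X 0 + C p.2 * X 1

/-- A binary form `f` has `m` distinct real roots: it factors over `ℝ` into `m`
pairwise non-proportional (nonzero) real linear forms, up to a nonzero constant. -/
noncomputable def HasDistinctRealRoots (f : MvPolynomial (Fin 2) ℝ) (m : ℕ) : Prop :=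
  ∃ (c : ℝ) (l : Fin m → ℝ × ℝ), c ≠ 0 ∧ (∀ i, l i ≠ 0) ∧
    (∀ i j, i ≠ j → (l i).1 * (l j).2 - (l j).1 * (l i).2 ≠ 0) ∧
    f = C c * ∏ i, lin (l i)

open Polynomial in
lemma eval_mul_eval_pos_of_no_root (g : ℝ[X]) (a b : ℝ)
    (h : ∀ z ∈ Set.uIcc a b, g.eval z ≠ 0) : 0 < g.eval a * g.eval b := by
  by_contra! hneg
  have h0 : (0 : ℝ) ∈ Set.uIcc (g.eval a) (g.eval b) := by
    have ha := h a Set.left_mem_uIcc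
    rw [Set.mem_uIcc]
    rcases lt_or_gt_of_ne ha with ha | ha
    · exact Or.inl ⟨ha.le, by by_contra! hb; exact hneg.not_gt (mul_pos_of_neg_of_neg ha hb)⟩
    · exact Or.inr ⟨by by_contra! hb; exact hneg.not_gt (mul_pos ha hb), ha.le⟩
  obtain ⟨z, hz, hz0⟩ := intermediate_value_uIcc g.continuous.continuousOn h0
  exact h z hz hz0

open Polynomial in
/-- At a critical point `x` with `p x * p'' x < 0`, the polynomial moves towards zero up to the
next critical point. -/
lemma eval_mul_sub_neg_of_critical (p : ℝ[X]) {x y : ℝ} (hxy : x ≠ y)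
    (hx : p.derivative.eval x = 0)
    (hpp : p.eval x * p.derivative.derivative.eval x < 0)
    (hne : ∀ z ∈ Set.Ioo (min x y) (max x y), p.derivative.eval z ≠ 0) :
    p.eval x * (p.eval y - p.eval x) < 0 := by
  obtain ⟨g, hg⟩ := dvd_iff_isRoot.2 hx
  have hgx : p.derivative.derivative.eval x = g.eval x := by simp [hg]
  have hev (z : ℝ) : p.derivative.eval z = (z - x) * g.eval z := by simp [hg]
  obtain ⟨ξ, hξ, hslope⟩ : ∃ ξ ∈ Set.Ioo (min x y) (max x y),
      p.eval y - p.eval x = p.derivative.eval ξ * (y - x) := by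
    rcases lt_or_gt_of_ne hxy with h | h
    · obtain ⟨ξ, hξ, he⟩ := exists_hasDerivAt_eq_slope (fun z => p.eval z)
        (fun z => p.derivative.eval z) h p.continuous.continuousOn fun z _ => p.hasDerivAt z
      refine ⟨ξ, by simpa [h.le] using hξ, ?_⟩
      have : y - x ≠ 0 := sub_ne_zero.2 h.ne'
      rw [he]; field_simp
    · obtain ⟨ξ, hξ, he⟩ := exists_hasDerivAt_eq_slope (fun z => p.eval z)
        (fun z => p.derivative.eval z) h p.continuous.continuousOn fun z _ => p.hasDerivAt z
      refine ⟨ξ, by simpa [h.le] using hξ, ?_⟩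
      have : x - y ≠ 0 := sub_ne_zero.2 h.ne'
      rw [he]; field_simp; ring
  have hside : 0 < (ξ - x) * (y - x) := by
    rcases lt_or_gt_of_ne hxy with h | h
    · rw [min_eq_left h.le, max_eq_right h.le] at hξ
      exact mul_pos (sub_pos.2 hξ.1) (sub_pos.2 h)
    · rw [min_eq_right h.le, max_eq_left h.le] at hξ
      exact mul_pos_of_neg_of_neg (sub_neg.2 hξ.2) (sub_neg.2 h)
  have hgpos : 0 < g.eval x * g.eval ξ := by
    apply eval_mul_eval_pos_of_no_root
    intro z hz hz0
    rcases eq_or_ne z x with rfl | hzx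
    · rw [hgx, hz0] at hpp; simp at hpp
    · refine hne z ?_ (by rw [hev, hz0, mul_zero])
      rcases lt_or_gt_of_ne hxy with h | h
      · rw [min_eq_left h.le, max_eq_right h.le] at *
        rw [Set.uIcc_of_le hξ.1.le] at hz
        exact ⟨lt_of_le_of_ne hz.1 hzx.symm, hz.2.trans_lt hξ.2⟩
      · rw [min_eq_right h.le, max_eq_left h.le] at *
        rw [Set.uIcc_of_ge hξ.2.le] at hz
        exact ⟨hξ.1.trans_le hz.1, lt_of_le_of_ne hz.2 hzx⟩
  have hfin : p.eval x * g.eval ξ < 0 := by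
    rw [hgx] at hpp
    by_contra! hc
    nlinarith [sq_nonneg (g.eval x), mul_nonneg hc hgpos.le, sq_nonneg (g.eval ξ),
      mul_neg_of_neg_of_pos hpp hgpos, mul_nonneg hc (sq_nonneg (g.eval x))]
  rw [hslope, hev]
  nlinarith [mul_neg_of_neg_of_pos hfin hside]

open Polynomial Filter in
lemma exists_abs_eval_gt (p : ℝ[X]) (hp : 0 < p.degree) (K : ℝ) :
    ∃ M : ℝ, 0 < M ∧ (∀ x, M ≤ |x| → K < |p.eval x|) := by
  obtain ⟨a, ha⟩ := eventually_atTop.1 ((p.abs_tendsto_atTop hp).eventually_gt_atTop K)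
  obtain ⟨b, hb⟩ := eventually_atTop.1
    (((p.comp (-Polynomial.X)).abs_tendsto_atTop (by
      rw [← natDegree_pos_iff_degree_pos] at hp ⊢
      simpa [natDegree_comp] using hp)).eventually_gt_atTop K)
  refine ⟨max 1 (max a b), by positivity, fun x hx => ?_⟩
  rcases le_total 0 x with h | h
  · rw [abs_of_nonneg h] at hx
    exact ha x (by simp only [max_le_iff] at hx; tauto)
  · rw [abs_of_nonpos h] at hx
    simpa using hb (-x) (by simp only [max_le_iff] at hx; tauto)

open Polynomial in
/-- If every critical point is real, simple and satisfies `p x * p'' x < 0`, then `p` has as many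
distinct real roots as its degree. -/
lemma natDegree_le_card_roots_of_critical (p : ℝ[X]) (hn : 2 ≤ p.natDegree)
    (hcard : p.derivative.roots.toFinset.card = p.natDegree - 1)
    (hpp : ∀ x, p.derivative.eval x = 0 → p.eval x * p.derivative.derivative.eval x < 0) :
    p.natDegree ≤ p.roots.toFinset.card := by
  set T := p.derivative.roots.toFinset with hT
  have hp0 : p ≠ 0 := by rintro rfl; simp at hn
  have hp'0 : p.derivative ≠ 0 := by
    intro h; have := natDegree_derivative p; rw [h] at this; simp at this; omega
  have hmem (x : ℝ) : x ∈ T ↔ p.derivative.eval x = 0 := by simp [hT, hp'0]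
  obtain ⟨M₁, hM₁, hK⟩ := exists_abs_eval_gt p (natDegree_pos_iff_degree_pos.1 (by omega))
    (∑ x ∈ T, |p.eval x|)
  have hK' {x y : ℝ} (hx : x ∈ T) (hy : M₁ ≤ |y|) : |p.eval x| < |p.eval y| :=
    (Finset.single_le_sum (f := fun x => |p.eval x|) (fun _ _ => abs_nonneg _) hx).trans_lt
      (hK y hy)
  set M := M₁ + ∑ x ∈ T, |x| with hM
  have hS0 : 0 ≤ ∑ x ∈ T, |x| := Finset.sum_nonneg fun _ _ => abs_nonneg _
  have hTM {x : ℝ} (hx : x ∈ T) : -M < x ∧ x < M := by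
    have := Finset.single_le_sum (f := fun x : ℝ => |x|) (fun _ _ => abs_nonneg _) hx
    exact abs_lt.1 (by linarith)
  have hMabs : M₁ ≤ |M| := by rw [abs_of_nonneg] <;> linarith
  have hsgn {x y : ℝ} (hxy : x < y) (h : p.eval x * p.eval y < 0) :
      ∃ z ∈ p.roots.toFinset, x < z ∧ z < y := by
    by_contra! hc
    refine (eval_mul_eval_pos_of_no_root p x y fun z hz hz0 => ?_).not_gt h
    rw [Set.uIcc_of_le hxy.le] at hz
    have hzx : z ≠ x := by rintro rfl; simp [hz0] at h
    have hzy : z ≠ y := by rintro rfl; simp [hz0] at h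
    exact (hc z (by simp [hp0, hz0]) (lt_of_le_of_ne hz.1 hzx.symm)).not_gt
      (lt_of_le_of_ne hz.2 hzy)
  obtain ⟨c, hc⟩ : T.Nonempty := Finset.card_pos.1 (by omega)
  have hMT : M ∉ T := fun h => (hTM h).2.false
  have hMT' : -M ∉ insert M T := by
    intro h
    rcases Finset.mem_insert.1 h with h | h
    · linarith
    · exact (hTM h).1.false
  have key : (insert (-M) (insert M T)).card ≤ p.roots.toFinset.card + 1 := by
    apply Finset.card_le_of_interleaved
    intro x hx y hy hxy hgap
    have hne : ∀ z ∈ Set.Ioo x y, p.derivative.eval z ≠ 0 := fun z hz h0 =>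
      hgap z (by simp [(hmem z).2 h0]) hz
    have hA (h : x ∈ T) : p.eval x * (p.eval y - p.eval x) < 0 :=
      eval_mul_sub_neg_of_critical p hxy.ne ((hmem x).1 h) (hpp x ((hmem x).1 h))
        (by simpa [hxy.le] using hne)
    have hB (h : y ∈ T) : p.eval y * (p.eval x - p.eval y) < 0 :=
      eval_mul_sub_neg_of_critical p hxy.ne' ((hmem y).1 h) (hpp y ((hmem y).1 h))
        (by simpa [hxy.le] using hne)
    apply hsgn hxy
    simp only [Finset.mem_insert] at hx hy
    rcases hx with rfl | rfl | hx
    · rcases hy with rfl | rfl | hy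
      · exact absurd hxy (lt_irrefl _)
      · exact absurd (hTM hc) (hgap c (by simp [hc]))
      · have h1 := sq_lt_sq.2 (hK' (y := -M) hy (by rwa [abs_neg]))
        have h2 := hB hy
        by_contra! h3
        rcases le_total 0 (p.eval y) with h | h <;> nlinarith
    · rcases hy with rfl | rfl | hy
      · linarith
      · exact absurd hxy (lt_irrefl _)
      · exact absurd (hTM hy).2 hxy.not_gt
    · rcases hy with rfl | rfl | hy
      · exact absurd (hTM hx).1 hxy.not_gt
      · have h1 := sq_lt_sq.2 (hK' hx hMabs)
        have h2 := hA hx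
        by_contra! h3
        nlinarith
      · have h1 := hA hx
        have h2 := hB hy
        by_contra! h3
        nlinarith
  rw [Finset.card_insert_of_notMem hMT', Finset.card_insert_of_notMem hMT] at key
  omega

open Polynomial in
/-- A real polynomial of degree `n ≥ 3` with real simple critical points and nowhere vanishing
Hessian determinant has `n` distinct real roots. -/
lemma natDegree_le_card_roots_of_hessian (p : ℝ[X]) (hn : 3 ≤ p.natDegree)
    (hcard : p.derivative.roots.toFinset.card = p.natDegree - 1)
    (hH : ∀ x, (p.natDegree : ℝ) * p.eval x * p.derivative.derivative.eval x -
      (p.natDegree - 1) * p.derivative.eval x ^ 2 ≠ 0) :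
    p.natDegree ≤ p.roots.toFinset.card := by
  have hn' : (3 : ℝ) ≤ p.natDegree := by exact_mod_cast hn
  set N : ℝ := (p.natDegree : ℝ)
  set H : ℝ[X] := Polynomial.C N * p * p.derivative.derivative -
    Polynomial.C (N - 1) * p.derivative ^ 2 with hHdef
  have hHe (x : ℝ) : H.eval x = N * p.eval x * p.derivative.derivative.eval x -
      (N - 1) * p.derivative.eval x ^ 2 := by simp [hHdef]
  have hHsame (x y : ℝ) : 0 < H.eval x * H.eval y :=
    eval_mul_eval_pos_of_no_root H x y fun z _ => by rw [hHe]; exact hH z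
  obtain ⟨a, ha, b, hb, hab⟩ := Finset.one_lt_card.1
    (show 1 < p.derivative.roots.toFinset.card by omega)
  have ha0 : p.derivative.eval a = 0 := by simp at ha; exact ha.2
  have hb0 : p.derivative.eval b = 0 := by simp at hb; exact hb.2
  rcases lt_or_ge (H.eval a) 0 with hneg | hpos
  · apply natDegree_le_card_roots_of_critical p (by omega) hcard
    intro x hx
    have h1 : H.eval x < 0 := by
      by_contra! h
      nlinarith [hHsame a x]
    rw [hHe, hx] at h1
    by_contra! h
    nlinarith
  · exfalso
    have h1 (x : ℝ) : 0 < H.eval x := by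
      by_contra! h
      nlinarith [hHsame a x]
    have hmul (x : ℝ) : 0 < p.eval x * p.derivative.derivative.eval x := by
      have := h1 x
      rw [hHe] at this
      by_contra! h
      nlinarith [sq_nonneg (p.derivative.eval x)]
    have rolle {x y : ℝ} (h : x < y) (hx : p.derivative.eval x = 0)
        (hy : p.derivative.eval y = 0) : ∃ c, p.derivative.derivative.eval c = 0 := by
      obtain ⟨c, -, hc⟩ := exists_hasDerivAt_eq_zero (f := fun z => p.derivative.eval z) h
        p.derivative.continuous.continuousOn (by simp [hx, hy])
        fun z _ => p.derivative.hasDerivAt z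
      exact ⟨c, hc⟩
    obtain ⟨c, hc0⟩ := (lt_or_gt_of_ne hab).elim (rolle · ha0 hb0) (rolle · hb0 ha0)
    have := hmul c
    simp [hc0] at this

open Polynomial in
/-- Restriction of a bivariate polynomial to the line `t ↦ t • v + w`. -/
noncomputable def alongLine (v w : ℝ × ℝ) : MvPolynomial (Fin 2) ℝ →ₐ[ℝ] ℝ[X] :=
  MvPolynomial.aeval ![Polynomial.C v.1 * Polynomial.X + Polynomial.C w.1,
    Polynomial.C v.2 * Polynomial.X + Polynomial.C w.2]

lemma alongLine_C (v w : ℝ × ℝ) (c : ℝ) : alongLine v w (C c) = Polynomial.C c := by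
  simp [alongLine]

lemma alongLine_lin (v w l : ℝ × ℝ) :
    alongLine v w (lin l) = Polynomial.C (l.1 * v.1 + l.2 * v.2) * Polynomial.X +
      Polynomial.C (l.1 * w.1 + l.2 * w.2) := by
  simp [alongLine, lin]
  ring

lemma eval_alongLine (v w : ℝ × ℝ) (f : MvPolynomial (Fin 2) ℝ) (t : ℝ) :
    (alongLine v w f).eval t = eval ![v.1 * t + w.1, v.2 * t + w.2] f := by
  induction f using MvPolynomial.induction_on with
  | C a => simp [alongLine]
  | add p q hp hq => simp [hp, hq]
  | mul_X p i hp =>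
    rw [map_mul, map_mul, Polynomial.eval_mul, hp]
    fin_cases i <;> simp [alongLine]

lemma derivative_alongLine (v w : ℝ × ℝ) (f : MvPolynomial (Fin 2) ℝ) :
    (alongLine v w f).derivative =
      Polynomial.C v.1 * alongLine v w (pderiv 0 f) +
        Polynomial.C v.2 * alongLine v w (pderiv 1 f) := by
  induction f using MvPolynomial.induction_on with
  | C a => simp [alongLine]
  | add p q hp hq => simp only [map_add, hp, hq]; ring
  | mul_X p i hp =>
    rw [map_mul, Polynomial.derivative_mul, hp]
    fin_cases i <;> simp [alongLine, pderiv_X] <;> ring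

lemma alongLine_euler (v w : ℝ × ℝ) {f : MvPolynomial (Fin 2) ℝ} {n : ℕ}
    (hf : f.IsHomogeneous n) :
    (Polynomial.C v.1 * Polynomial.X + Polynomial.C w.1) * alongLine v w (pderiv 0 f) +
      (Polynomial.C v.2 * Polynomial.X + Polynomial.C w.2) * alongLine v w (pderiv 1 f) =
      Polynomial.C (n : ℝ) * alongLine v w f := by
  have h := congrArg (alongLine v w) hf.sum_X_mul_pderiv
  simpa [Fin.sum_univ_two, alongLine] using h

lemma MvPolynomial.IsHomogeneous.eval_const_mul {σ R : Type*} [CommSemiring R]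
    {f : MvPolynomial σ R} {n : ℕ} (hf : f.IsHomogeneous n) (s : R) (x : σ → R) :
    eval (fun i => s * x i) f = s ^ n * eval x f := by
  rw [eval_eq, eval_eq, Finset.mul_sum]
  refine Finset.sum_congr rfl fun d hd => ?_
  simp_rw [mul_pow, Finset.prod_mul_distrib, Finset.prod_pow_eq_pow_sum]
  have hdeg : ∑ i ∈ d.support, d i = n := by
    rw [← hf (mem_support_iff.1 hd), ← Finsupp.degree_apply,
      Finsupp.degree_eq_weight_one]
    rfl
  rw [hdeg]
  ring

lemma lin_ne_zero {l : ℝ × ℝ} (hl : l ≠ 0) : lin l ≠ 0 := by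
  intro h
  apply hl
  have h0 := congrArg (eval ![1, 0]) h
  have h1 := congrArg (eval ![0, 1]) h
  simp [lin] at h0 h1
  exact Prod.ext h0 h1

lemma isHomogeneous_lin (l : ℝ × ℝ) : (lin l).IsHomogeneous 1 :=
  ((isHomogeneous_X _ _).C_mul _).add ((isHomogeneous_X _ _).C_mul _)

/-- A binary form is determined by its restriction to a line that avoids the origin. -/
lemma eq_of_alongLine_eq {v w : ℝ × ℝ} (hvw : v.1 * w.2 - v.2 * w.1 ≠ 0)
    {f g : MvPolynomial (Fin 2) ℝ} {n : ℕ} (hf : f.IsHomogeneous n) (hg : g.IsHomogeneous n)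
    (h : alongLine v w f = alongLine v w g) : f = g := by
  have hv : ((-v.2, v.1) : ℝ × ℝ) ≠ 0 := by
    rintro h
    simp only [Prod.mk_eq_zero, neg_eq_zero] at h
    simp [h.1, h.2] at hvw
  rw [← sub_eq_zero]
  refine (mul_eq_zero.1 (MvPolynomial.funext fun x => ?_ :
    (f - g) * lin (-v.2, v.1) = 0)).resolve_right (lin_ne_zero hv)
  set s := (v.1 * x 1 - v.2 * x 0) / (v.1 * w.2 - v.2 * w.1)
  by_cases hs0 : v.1 * x 1 - v.2 * x 0 = 0
  · simp only [map_mul, map_zero, lin, map_add, eval_C, eval_X]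
    rw [show -v.2 * x 0 + v.1 * x 1 = 0 by linarith, mul_zero]
  · set t := (x 0 * w.2 - x 1 * w.1) / (v.1 * x 1 - v.2 * x 0)
    have hx : x = fun i => s * (![v.1 * t + w.1, v.2 * t + w.2] : Fin 2 → ℝ) i := by
      funext i
      have hsD : s * (v.1 * w.2 - v.2 * w.1) = v.1 * x 1 - v.2 * x 0 := div_mul_cancel₀ _ hvw
      have htx : t * (v.1 * x 1 - v.2 * x 0) = x 0 * w.2 - x 1 * w.1 := div_mul_cancel₀ _ hs0
      have hst : s * t * (v.1 * w.2 - v.2 * w.1) = x 0 * w.2 - x 1 * w.1 := by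
        linear_combination t * hsD + htx
      fin_cases i <;> refine mul_left_cancel₀ hvw ?_ <;> dsimp
      · linear_combination -v.1 * hst - w.1 * hsD
      · linear_combination -v.2 * hst - w.2 * hsD
    have h2 : eval x (f - g) = 0 := by
      rw [hx, (hf.sub hg).eval_const_mul, ← eval_alongLine, map_sub, h, sub_self]
      simp
    rw [map_mul, h2, zero_mul, map_zero]

lemma HasDistinctRealRoots.derivative_alongLine_ne_zero {F : MvPolynomial (Fin 2) ℝ} {m : ℕ}
    (hF : HasDistinctRealRoots F m) {v w : ℝ × ℝ} (hvw : v.1 * w.2 - v.2 * w.1 ≠ 0) {t : ℝ}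
    (ht : (alongLine v w F).eval t = 0) : (alongLine v w F).derivative.eval t ≠ 0 := by
  obtain ⟨c, l, hc, hl, hdet, rfl⟩ := hF
  have hpt (i : Fin m) : (alongLine v w (lin (l i))).eval t =
      (l i).1 * (v.1 * t + w.1) + (l i).2 * (v.2 * t + w.2) := by
    simp [alongLine_lin]; ring
  simp only [map_mul, map_prod, alongLine_C, Polynomial.eval_mul, Polynomial.eval_C,
    Polynomial.eval_prod, mul_eq_zero, hc, false_or, Finset.prod_eq_zero_iff] at ht
  obtain ⟨i, -, hi⟩ := ht
  have hother (j : Fin m) (hj : j ≠ i) : (alongLine v w (lin (l j))).eval t ≠ 0 := by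
    intro hj0
    rw [hpt] at hi hj0
    have h1 : ((l i).1 * (l j).2 - (l j).1 * (l i).2) * (v.1 * t + w.1) = 0 := by
      linear_combination (l j).2 * hi - (l i).2 * hj0
    have h2 : ((l i).1 * (l j).2 - (l j).1 * (l i).2) * (v.2 * t + w.2) = 0 := by
      linear_combination (l i).1 * hj0 - (l j).1 * hi
    have h1' := (mul_eq_zero.1 h1).resolve_left (hdet i j hj.symm)
    have h2' := (mul_eq_zero.1 h2).resolve_left (hdet i j hj.symm)
    exact hvw (by linear_combination v.1 * h2' - v.2 * h1')
  rw [← Finset.mul_prod_erase Finset.univ _ (Finset.mem_univ i)]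
  simp only [map_mul, map_prod, alongLine_C, Polynomial.derivative_mul, Polynomial.derivative_C,
    Polynomial.eval_add, Polynomial.eval_mul, Polynomial.eval_C, hi, zero_mul, zero_add,
    add_zero, Polynomial.eval_prod]
  refine mul_ne_zero hc (mul_ne_zero ?_
    (Finset.prod_ne_zero_iff.2 fun j hj => hother j (Finset.ne_of_mem_erase hj)))
  intro h0
  rw [alongLine_lin] at h0
  simp at h0
  rw [hpt] at hi
  have h1 : (l i).1 * w.1 + (l i).2 * w.2 = 0 := by linear_combination hi - t * h0
  refine hl i (Prod.ext ((mul_eq_zero.1 ?_).resolve_right hvw)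
    ((mul_eq_zero.1 ?_).resolve_right hvw))
  · linear_combination w.2 * h0 - v.2 * h1
  · linear_combination v.1 * h1 - w.1 * h0

lemma HasDistinctRealRoots.natDegree_and_card_roots_alongLine {F : MvPolynomial (Fin 2) ℝ}
    {m : ℕ} (hF : HasDistinctRealRoots F m) {v w : ℝ × ℝ}
    (hvw : v.1 * w.2 - v.2 * w.1 ≠ 0) (hv : eval ![v.1, v.2] F ≠ 0) :
    (alongLine v w F).natDegree = m ∧ (alongLine v w F).roots.toFinset.card = m := by
  obtain ⟨c, l, hc, hl, hdet, rfl⟩ := hF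
  have hA (i : Fin m) : (l i).1 * v.1 + (l i).2 * v.2 ≠ 0 := by
    intro h
    refine hv ?_
    rw [map_mul, map_prod, Finset.prod_eq_zero (Finset.mem_univ i), mul_zero]
    simpa [lin] using h
  have hne (i : Fin m) : alongLine v w (lin (l i)) ≠ 0 := by
    intro h
    have := congrArg (Polynomial.coeff · 1) h
    simp [alongLine_lin] at this
    exact hA i this
  have hdeg : (alongLine v w (C c * ∏ i, lin (l i))).natDegree = m := by
    rw [map_mul, map_prod, alongLine_C, Polynomial.natDegree_C_mul hc,
      Polynomial.natDegree_prod _ _ fun i _ => hne i]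
    simp_rw [alongLine_lin, Polynomial.natDegree_linear (hA _)]
    simp
  have hne0 : alongLine v w (C c * ∏ i, lin (l i)) ≠ 0 := by
    rw [map_mul, map_prod, alongLine_C]
    exact mul_ne_zero (by simpa using hc) (Finset.prod_ne_zero_iff.2 fun i _ => hne i)
  refine ⟨hdeg, le_antisymm ?_ ?_⟩
  · exact (Multiset.toFinset_card_le _).trans ((Polynomial.card_roots' _).trans hdeg.le)
  · set r : Fin m → ℝ := fun i =>
      -((l i).1 * w.1 + (l i).2 * w.2) / ((l i).1 * v.1 + (l i).2 * v.2) with hr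
    have hri (i : Fin m) : ((l i).1 * v.1 + (l i).2 * v.2) * r i +
        ((l i).1 * w.1 + (l i).2 * w.2) = 0 := by
      have := hA i
      simp only [hr]
      field_simp
      ring
    have hinj : Function.Injective r := by
      intro i j hij
      by_contra hne'
      have hi := hri i
      have hj := hri j
      rw [← hij] at hj
      have h1 : ((l i).1 * (l j).2 - (l j).1 * (l i).2) * (v.1 * r i + w.1) = 0 := by
        linear_combination (l j).2 * hi - (l i).2 * hj
      have h2 : ((l i).1 * (l j).2 - (l j).1 * (l i).2) * (v.2 * r i + w.2) = 0 := by
        linear_combination (l i).1 * hj - (l j).1 * hi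
      have h1' := (mul_eq_zero.1 h1).resolve_left (hdet i j hne')
      have h2' := (mul_eq_zero.1 h2).resolve_left (hdet i j hne')
      exact hvw (by linear_combination v.1 * h2' - v.2 * h1')
    calc m = (Finset.univ.image r).card := by
          rw [Finset.card_image_of_injective _ hinj, Finset.card_fin]
      _ ≤ _ := Finset.card_le_card fun x hx => by
          obtain ⟨i, -, rfl⟩ := Finset.mem_image.1 hx
          rw [Multiset.mem_toFinset, Polynomial.mem_roots hne0, Polynomial.IsRoot.def, map_mul,
            map_prod, Polynomial.eval_mul, Polynomial.eval_prod,
            Finset.prod_eq_zero (Finset.mem_univ i), mul_zero]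
          simpa [alongLine_lin] using hri i

open Polynomial in
lemma exists_eq_C_mul_prod_of_natDegree_le_card_roots {R : Type*} [CommRing R] [IsDomain R]
    [DecidableEq R] (p : R[X]) (h : p.natDegree ≤ p.roots.toFinset.card) :
    ∃ s : Fin p.natDegree → R, Function.Injective s ∧
      p = Polynomial.C p.leadingCoeff * ∏ i, (Polynomial.X - Polynomial.C (s i)) := by
  have hle := Multiset.toFinset_card_le p.roots
  have hle' := p.card_roots'
  have hcard : p.roots.toFinset.card = p.natDegree := by omega
  have hroots : p.roots.card = p.natDegree := by omega
  have hnd : p.roots.Nodup := Multiset.toFinset_card_eq_card_iff_nodup.1 (by omega)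
  let e := (p.roots.toFinset.equivFinOfCardEq hcard).symm
  refine ⟨fun i => e i, Subtype.val_injective.comp e.injective, ?_⟩
  rw [e.prod_comp (fun x => Polynomial.X - Polynomial.C (x : R)),
    Finset.prod_coe_sort p.roots.toFinset (fun x => Polynomial.X - Polynomial.C x),
    Finset.prod, Multiset.toFinset_val, hnd.dedup]
  exact (C_leadingCoeff_mul_prod_multiset_X_sub_C hroots).symm

theorem stmt_0 (n : ℕ) (hn : 3 ≤ n) (f : MvPolynomial (Fin 2) ℝ)
    (hhom : f.IsHomogeneous n)
    (hsf : Squarefree (MvPolynomial.map (algebraMap ℝ ℂ) f))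
    (hder : ∀ α β : ℝ, (α, β) ≠ (0, 0) →
      HasDistinctRealRoots (C α * pderiv 0 f + C β * pderiv 1 f) (n - 1)) :
    HasDistinctRealRoots f n := by
  have hf0 : f ≠ 0 := by
    rintro rfl
    simp at hsf
  obtain ⟨v, hv⟩ : ∃ v : ℝ × ℝ, eval ![v.1, v.2] f ≠ 0 := by
    by_contra! h
    refine hf0 (MvPolynomial.funext fun x => ?_)
    have hx : x = ![x 0, x 1] := by funext i; fin_cases i <;> rfl
    rw [hx, h (x 0, x 1), map_zero]
  have hn0 : (n : ℝ) ≠ 0 := by positivity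
  have hv0 : (v.1, v.2) ≠ (0, 0) := by
    intro h
    simp only [Prod.mk.injEq] at h
    have h1 := hhom.eval_const_mul 0 ![v.1, v.2]
    rw [zero_pow (by omega), zero_mul] at h1
    refine hv (Eq.trans ?_ h1)
    congr 2
    funext i
    fin_cases i <;> simp [h.1, h.2]
  set w : ℝ × ℝ := (-v.2, v.1) with hw
  set D : ℝ := v.1 * w.2 - v.2 * w.1 with hD
  have hD0 : D ≠ 0 := by
    have hD' : D = v.1 ^ 2 + v.2 ^ 2 := by simp only [hD, hw]; ring
    rw [hD']
    intro h
    exact hv0 (Prod.ext (by simp; nlinarith [sq_nonneg v.1, sq_nonneg v.2])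
      (by simp; nlinarith [sq_nonneg v.1, sq_nonneg v.2]))
  set p := alongLine v w f with hp
  have hp' : p.derivative = alongLine v w (C v.1 * pderiv 0 f + C v.2 * pderiv 1 f) := by
    rw [hp, derivative_alongLine, map_add, map_mul, map_mul, alongLine_C, alongLine_C]
  have hveval : eval ![v.1, v.2] (C v.1 * pderiv 0 f + C v.2 * pderiv 1 f) ≠ 0 := by
    have := congrArg (eval ![v.1, v.2]) hhom.sum_X_mul_pderiv
    simp [Fin.sum_univ_two] at this
    simp [this]
    exact ⟨by omega, hv⟩
  obtain ⟨hdeg', hcard'⟩ := (hder v.1 v.2 hv0).natDegree_and_card_roots_alongLine hD0 hveval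
  rw [← hp'] at hdeg' hcard'
  have hdeg : p.natDegree = n := by
    have := Polynomial.natDegree_derivative p
    omega
  have hH (t : ℝ) : (p.natDegree : ℝ) * p.eval t * p.derivative.derivative.eval t -
      (p.natDegree - 1) * p.derivative.eval t ^ 2 ≠ 0 := by
    intro h0
    rw [hdeg] at h0
    have hq (α β : ℝ) : alongLine v w (C (α * v.1 + β * w.1) * pderiv 0 f +
        C (α * v.2 + β * w.2) * pderiv 1 f) = Polynomial.C α * p.derivative +
          Polynomial.C β * (Polynomial.C (n : ℝ) * p - Polynomial.X * p.derivative) := by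
      rw [← alongLine_euler v w hhom, hp, derivative_alongLine]
      simp only [map_add, map_mul, alongLine_C]
      ring
    obtain ⟨α, β, hαβ, h1, h2⟩ : ∃ α β : ℝ, (α ≠ 0 ∨ β ≠ 0) ∧
        α * p.derivative.eval t + β * (n * p.eval t - t * p.derivative.eval t) = 0 ∧
        α * p.derivative.derivative.eval t + β * ((n - 1) * p.derivative.eval t -
          t * p.derivative.derivative.eval t) = 0 := by
      by_cases hz : p.derivative.eval t = 0 ∧ p.derivative.derivative.eval t = 0
      · exact ⟨1, 0, by simp, by simp [hz.1], by simp [hz.2]⟩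
      · set a := p.derivative.eval t
        set b := p.derivative.derivative.eval t
        by_cases ha : a = 0
        · have hb : b ≠ 0 := fun hb => hz ⟨ha, hb⟩
          refine ⟨t, 1, by simp, ?_, by rw [ha]; ring⟩
          rw [ha] at h0 ⊢
          have hpe : p.eval t = 0 := by
            have : (n : ℝ) * (p.eval t * b) = 0 := by linear_combination h0
            exact (mul_eq_zero.1 ((mul_eq_zero.1 this).resolve_left hn0)).resolve_right hb
          rw [hpe]; ring
        · exact ⟨-(n * p.eval t - t * a), a, Or.inr ha, by ring, by linear_combination -h0⟩
    have hne : (α * v.1 + β * w.1, α * v.2 + β * w.2) ≠ (0, 0) := by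
      intro h
      simp only [Prod.mk.injEq] at h
      rcases hαβ with h3 | h3
      · exact mul_ne_zero h3 hD0 (by rw [hD]; linear_combination w.2 * h.1 - w.1 * h.2)
      · exact mul_ne_zero h3 hD0 (by rw [hD]; linear_combination v.1 * h.2 - v.2 * h.1)
    have hroot := hder _ _ hne
    refine hroot.derivative_alongLine_ne_zero hD0 (t := t) ?_ ?_
    · rw [hq]; simpa using h1
    · rw [hq]; simp; linear_combination h2
  obtain ⟨s, hsinj, hps⟩ := exists_eq_C_mul_prod_of_natDegree_le_card_roots p
    (natDegree_le_card_roots_of_hessian p (by omega) (by rw [hcard', hdeg]) hH)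
  have hp0 : p ≠ 0 := by
    intro h
    simp [h] at hdeg
    omega
  revert s
  rw [hdeg]
  intro s hsinj hps
  have hlin (i : Fin n) : alongLine v w (lin (v.2 * s i + w.2, -(v.1 * s i + w.1))) =
      Polynomial.C D * (Polynomial.X - Polynomial.C (s i)) := by
    rw [alongLine_lin, mul_sub, ← Polynomial.C_mul, sub_eq_add_neg, ← Polynomial.C_neg]
    congr 2
    · congr 1; rw [hD]; ring
    · rw [hD]; ring
  have hD_pow : D ^ n ≠ 0 := pow_ne_zero _ hD0
  refine ⟨p.leadingCoeff / D ^ n, fun i => (v.2 * s i + w.2, -(v.1 * s i + w.1)),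
    div_ne_zero (by simpa using hp0) hD_pow, ?_, ?_, ?_⟩
  · intro i h
    simp only [Prod.mk_eq_zero, neg_eq_zero] at h
    exact hD0 (by rw [hD]; linear_combination v.1 * h.1 - v.2 * h.2)
  · intro i j hij h
    refine mul_ne_zero hD0 (sub_ne_zero.2 (hsinj.ne hij)) ?_
    rw [hD]
    linear_combination h
  · refine eq_of_alongLine_eq hD0 hhom ?_ ?_
    · have h1 := IsHomogeneous.prod Finset.univ
        (fun i => lin (v.2 * s i + w.2, -(v.1 * s i + w.1))) (fun _ => 1)
        fun i _ => isHomogeneous_lin _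
      simp only [Finset.sum_const, Finset.card_fin, smul_eq_mul, mul_one] at h1
      exact h1.C_mul _
    · rw [map_mul, map_prod, alongLine_C]
      simp_rw [hlin]
      rw [Finset.prod_mul_distrib, Finset.prod_const, Finset.card_fin, ← mul_assoc,
        ← Polynomial.C_pow, ← Polynomial.C_mul, div_mul_cancel₀ _ hD_pow]
      exact hps
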